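/- (Lattice-point identity for A_{n−1}.) Let n ≥ 1. Then in K₃ one has A_n = 1 + (y+1)·( T₁^n/(1 − T₁^n) + T₂^n/(1 − T₂^n) ) + (y+1)² · (1 − T₁^n)⁻¹ · (1 − T₂^n)⁻¹ · Σ_{k=1}^{n} (T₁·T₂)^k, i.e. the lattice-point-counting expression for the equivariant Hirzebruch class of the toric A_{n−1} singularity equals the hypersurface expression A_n. -/

import Mathlib

open scoped BigOperators

/-- The fraction field `K₃` of the polynomial ring `ℂ[y, T₁, T₂]` in three variables. -/
noncomputable abbrev K3 : Type := FractionRing (MvPolynomial (Fin 3) ℂ)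

/-- The variable `y ∈ K₃`. -/
noncomputable abbrev k3y : K3 := algebraMap (MvPolynomial (Fin 3) ℂ) K3 (MvPolynomial.X 0)

/-- The variable `T₁ ∈ K₃`. -/
noncomputable abbrev k3T1 : K3 := algebraMap (MvPolynomial (Fin 3) ℂ) K3 (MvPolynomial.X 1)

/-- The variable `T₂ ∈ K₃`. -/
noncomputable abbrev k3T2 : K3 := algebraMap (MvPolynomial (Fin 3) ℂ) K3 (MvPolynomial.X 2)

/-- The hypersurface expression for the two-torus-equivariant Hirzebruch class of the
`A_{n−1}` singularity:
`A_n = (1+y)(1 + T₁T₂y)(1 − (T₁T₂)^n)/((1 − T₁T₂)(1 − T₁^n)(1 − T₂^n)) − y ∈ K₃`. -/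
noncomputable def Ahyp (n : ℕ) : K3 :=
  (1 + k3y) * (1 + k3T1 * k3T2 * k3y) * (1 - (k3T1 * k3T2) ^ n) /
    ((1 - k3T1 * k3T2) * (1 - k3T1 ^ n) * (1 - k3T2 ^ n)) - k3y

theorem one_sub_algebraMap_ne_zero {p : MvPolynomial (Fin 3) ℂ}
    (hp : MvPolynomial.eval 0 p = 0) :
    1 - algebraMap (MvPolynomial (Fin 3) ℂ) K3 p ≠ 0 := by
  rw [sub_ne_zero, ← map_one (algebraMap (MvPolynomial (Fin 3) ℂ) K3)]
  intro h
  rw [← IsFractionRing.injective _ _ h] at hp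
  simp at hp

theorem lattice_point_formula_of_ne_zero {F : Type*} [Field F] (y s t : F) (n : ℕ)
    (hst : 1 - s * t ≠ 0) (hs : 1 - s ^ n ≠ 0) (ht : 1 - t ^ n ≠ 0) :
    (1 + y) * (1 + s * t * y) * (1 - (s * t) ^ n) /
        ((1 - s * t) * (1 - s ^ n) * (1 - t ^ n)) - y =
      1 + (y + 1) * (s ^ n / (1 - s ^ n) + t ^ n / (1 - t ^ n))
        + (y + 1) ^ 2 * (1 - s ^ n)⁻¹ * (1 - t ^ n)⁻¹ *
          ∑ k ∈ Finset.Icc 1 n, (s * t) ^ k := by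
  have sum_eq : ∑ k ∈ Finset.Icc 1 n, (s * t) ^ k =
      s * t * (1 - s ^ n * t ^ n) / (1 - s * t) := by
    rw [eq_div_iff hst, ← mul_pow]
    clear hs ht
    induction n with
    | zero => simp
    | succ k ih =>
      rw [Finset.sum_Icc_succ_top (by omega), add_mul, ih]
      ring
  rw [sum_eq, mul_pow]
  generalize s ^ n = a at *
  generalize t ^ n = b at *
  generalize s * t = q at *
  field_simp
  ring

/-- **Lattice-point identity for `A_{n−1}`.** For `n ≥ 1`, the lattice-point-counting
expression for the equivariant Hirzebruch class of the toric `A_{n−1}` singularity,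
`1 + (y+1)(T₁^n/(1 − T₁^n) + T₂^n/(1 − T₂^n)) +
(y+1)²·(1 − T₁^n)⁻¹·(1 − T₂^n)⁻¹·∑_{k=1}^{n} (T₁T₂)^k`,
equals the hypersurface expression `A_n` in `K₃`. -/
theorem Anminus1_lattice_point_formula (n : ℕ) (hn : 1 ≤ n) :
    Ahyp n =
      1 + (k3y + 1) * (k3T1 ^ n / (1 - k3T1 ^ n) + k3T2 ^ n / (1 - k3T2 ^ n))
        + (k3y + 1) ^ 2 * (1 - k3T1 ^ n)⁻¹ * (1 - k3T2 ^ n)⁻¹ *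
          ∑ k ∈ Finset.Icc 1 n, (k3T1 * k3T2) ^ k := by
  have hn' : n ≠ 0 := by omega
  apply lattice_point_formula_of_ne_zero
  · rw [← map_mul]
    exact one_sub_algebraMap_ne_zero (by simp)
  · rw [← map_pow]
    exact one_sub_algebraMap_ne_zero (by simp [hn'])
  · rw [← map_pow]
    exact one_sub_algebraMap_ne_zero (by simp [hn'])
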